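/- Let U : [0,∞) → ℝ be concave and strictly increasing and define ū(k) = max_{c,g ≥ 0, c+g = k} U(c^α/α + ((g−a)⁺)^β/β) for k ≥ 0. Then lim_{k→0⁺} ( ū(k) − ū(0) ) / k = +∞ (the marginal total utility blows up at zero, so the individual consumes basic goods even when wealth is very small). -/

import Mathlib

/-- The total consumption utility `ū(k) = max_{c,g ≥ 0, c+g=k} U(c^α/α + ((g-a)⁺)^β/β)`. -/
noncomputable def ubar (α β a : ℝ) (U : ℝ → ℝ) (k : ℝ) : ℝ :=
  sSup {v | ∃ c g : ℝ, 0 ≤ c ∧ 0 ≤ g ∧ c + g = k ∧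
    v = U (c ^ α / α + (max (g - a) 0) ^ β / β)}

theorem le_ubar {α β a : ℝ} {U : ℝ → ℝ} (hα : 0 < α) (hβ : 0 < β) (ha : 0 < a)
    (hU : MonotoneOn U (Set.Ici 0)) {k : ℝ} (hk : 0 ≤ k) :
    U (k ^ α / α) ≤ ubar α β a U k := by
  refine le_csSup ⟨U (k ^ α / α + k ^ β / β), ?_⟩
    ⟨k, 0, hk, le_rfl, add_zero k, ?_⟩
  · rintro v ⟨c, g, hc, hg, hcg, rfl⟩
    have hck : c ≤ k := by linarith
    have hgk : max (g - a) 0 ≤ k := max_le (by linarith) hk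
    refine hU (Set.mem_Ici.2 (by positivity)) (Set.mem_Ici.2 (by positivity)) ?_
    gcongr
  · rw [max_eq_right (by linarith), Real.zero_rpow hβ.ne', zero_div, add_zero]

theorem ubar_zero {α β a : ℝ} (U : ℝ → ℝ) (hα : 0 < α) (hβ : 0 < β) (ha : 0 < a) :
    ubar α β a U 0 = U 0 := by
  have hset : {v | ∃ c g : ℝ, 0 ≤ c ∧ 0 ≤ g ∧ c + g = 0 ∧
      v = U (c ^ α / α + (max (g - a) 0) ^ β / β)} = {U 0} := by
    ext v
    simp only [Set.mem_ofPred_eq, Set.mem_singleton_iff]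
    constructor
    · rintro ⟨c, g, hc, hg, hcg, rfl⟩
      obtain rfl : c = 0 := by linarith
      obtain rfl : g = 0 := by linarith
      simp [Real.zero_rpow, hα.ne', hβ.ne', ha.le]
    · rintro rfl
      refine ⟨0, 0, le_rfl, le_rfl, add_zero 0, ?_⟩
      simp [Real.zero_rpow, hα.ne', hβ.ne', ha.le]
  rw [ubar, hset, csSup_singleton]

theorem ConcaveOn.mul_sub_le_sub_zero {U : ℝ → ℝ} (hU : ConcaveOn ℝ (Set.Ici 0) U)
    {t : ℝ} (ht₀ : 0 ≤ t) (ht₁ : t ≤ 1) : t * (U 1 - U 0) ≤ U t - U 0 := by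
  have h := hU.2 (Set.mem_Ici.2 le_rfl) (Set.mem_Ici.2 zero_le_one)
    (sub_nonneg.2 ht₁) ht₀ (sub_add_cancel 1 t)
  simp only [smul_eq_mul, mul_zero, mul_one, zero_add] at h
  linarith

/-- If `U` is concave and strictly increasing on `[0,∞)`, the marginal total utility
blows up at zero: `(ū(k) - ū(0))/k → +∞` as `k → 0⁺`. -/
theorem stmt_8 (α β a : ℝ) (hα : 0 < α) (hαβ : α < β) (hβ : β < 1) (ha : 0 < a)
    (U : ℝ → ℝ) (hUconc : ConcaveOn ℝ (Set.Ici 0) U)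
    (hUmono : StrictMonoOn U (Set.Ici 0)) :
    Filter.Tendsto (fun k => (ubar α β a U k - ubar α β a U 0) / k)
      (nhdsWithin 0 (Set.Ioi 0)) Filter.atTop := by
  have hβ₀ : 0 < β := hα.trans hαβ
  have hU : 0 < U 1 - U 0 := sub_pos.2
    (hUmono (Set.mem_Ici.2 le_rfl) (Set.mem_Ici.2 zero_le_one) zero_lt_one)
  have hlim : Filter.Tendsto (fun k : ℝ => (U 1 - U 0) / α * k ^ (α - 1))
      (nhdsWithin 0 (Set.Ioi 0)) Filter.atTop :=
    (tendsto_rpow_neg_nhdsGT_zero (by linarith)).const_mul_atTop (div_pos hU hα)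
  have hsmall : ∀ᶠ k : ℝ in nhdsWithin 0 (Set.Ioi 0), k ^ α / α < 1 := by
    have hcont : ContinuousAt (fun k : ℝ => k ^ α / α) 0 :=
      (Real.continuousAt_rpow_const 0 α (Or.inr hα.le)).div_const α
    refine nhdsWithin_le_nhds (hcont.eventually_lt continuousAt_const ?_)
    simp [Real.zero_rpow hα.ne']
  refine Filter.tendsto_atTop_mono' _ ?_ hlim
  filter_upwards [hsmall, self_mem_nhdsWithin] with k hk₁ hk
  have hk₀ : 0 < k := hk
  rw [ubar_zero U hα hβ₀ ha, le_div_iff₀ hk₀]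
  calc (U 1 - U 0) / α * k ^ (α - 1) * k = k ^ α / α * (U 1 - U 0) := by
        rw [Real.rpow_sub_one hk₀.ne']
        field_simp
    _ ≤ U (k ^ α / α) - U 0 := hUconc.mul_sub_le_sub_zero (by positivity) hk₁.le
    _ ≤ ubar α β a U k - U 0 :=
        sub_le_sub_right (le_ubar hα hβ₀ ha hUmono.monotoneOn hk₀.le) _
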